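/- Let u₀(x) = −1/√(−x) for x < −1 and u₀(x) = 0 for x ≥ −1, so that u₀ is bounded with ‖u₀‖_{L∞} = 1. For each λ ≥ 0 define w_λ : ℝ × (0,∞) → ℝ by w_λ(x,t) = −1/√(−x) if x < −(max(2−t,0))²/4; w_λ(x,t) = 1/√x if 0 < x < (max(t−2−λ,0))²/4; and w_λ(x,t) = 0 otherwise. Then: (i) for every λ ≥ 0, w_λ satisfies the Kružkov entropy inequality for the flux f(x,u) = x·u² with initial datum u₀; (ii) for every λ ≥ 0 and every compact set K ⊂ ℝ, ∫_K |w_λ(x,t) − u₀(x)| dx → 0 as t → 0⁺; (iii) if λ ≠ μ then w_λ and w_μ differ on a set of positive Lebesgue measure in ℝ × (0,∞). In particular, the Cauchy problem for u_t + (x u²)_x = 0 with the bounded initial datum u₀ admits infinitely many Kružkov entropy solutions, each continuous in time with respect to the L¹_loc norm. -/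

import Mathlib

open MeasureTheory Set Filter

/-- The sign function: `1` for `s ≥ 0`, `−1` for `s < 0`. -/
noncomputable def sgn (s : ℝ) : ℝ := if 0 ≤ s then 1 else -1

/-- The bounded initial datum `u₀(x) = −1/√(−x)` for `x < −1`, `0` for `x ≥ −1`. -/
noncomputable def uInit (x : ℝ) : ℝ := if x < -1 then -1 / Real.sqrt (-x) else 0

/-- The family of candidate solutions `w_λ`, written at points `(x, t)`:
`w_λ(x,t) = −1/√(−x)` if `x < −(max(2−t,0))²/4`; `1/√x` if `0 < x < (max(t−2−λ,0))²/4`;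
`0` otherwise. -/
noncomputable def wFam (lam : ℝ) (p : ℝ × ℝ) : ℝ :=
  if p.1 < -((max (2 - p.2) 0) ^ 2 / 4) then -1 / Real.sqrt (-p.1)
  else if 0 < p.1 ∧ p.1 < (max (p.2 - 2 - lam) 0) ^ 2 / 4 then 1 / Real.sqrt p.1
  else 0

/-- `u` satisfies the Kružkov entropy inequality for the flux `f(x,u) = x u²`
with initial datum `w₀`. -/
def EntropySol (u : ℝ × ℝ → ℝ) (w₀ : ℝ → ℝ) : Prop :=
  ∀ (k : ℝ) (φ : ℝ × ℝ → ℝ), ContDiff ℝ (⊤ : ℕ∞) φ → HasCompactSupport φ →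
    (∀ p, 0 ≤ φ p) →
    0 ≤ (∫ t in Ioi (0 : ℝ), ∫ x : ℝ,
          (|u (x, t) - k| * fderiv ℝ φ (x, t) (0, 1)
            + sgn (u (x, t) - k) * (x * (u (x, t)) ^ 2 - x * k ^ 2)
                * fderiv ℝ φ (x, t) (1, 0)
            - sgn (u (x, t) - k) * k ^ 2 * φ (x, t)))
        + ∫ x : ℝ, |w₀ x - k| * φ (x, 0)


noncomputable def mm (k r : ℝ) : ℝ := |1 - r * k| - |r * k|
noncomputable def DD (k r : ℝ) : ℝ := |1 - r * k| * (1 + r * k) - r * k * |r * k|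
noncomputable def Dp (k r : ℝ) : ℝ := sgn (1 - r * k) * (-2 * r * k ^ 2) - 2 * |r| * k * |k|

lemma mm_cont (k : ℝ) : Continuous (mm k) := by unfold mm; fun_prop
lemma DD_cont (k : ℝ) : Continuous (DD k) := by unfold DD; fun_prop

lemma DD_zero (k : ℝ) : DD k 0 = 1 := by simp [DD]

lemma mm_le_DD (k r : ℝ) : mm k r ≤ DD k r := by
  unfold mm DD
  generalize r * k = z
  rcases le_total 0 z with h | h
  · rw [abs_of_nonneg h]
    have := neg_abs_le (1 - z)
    nlinarith [mul_nonneg h (by linarith : 0 ≤ |1 - z| + (1 - z))]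
  · rw [abs_of_nonpos h, abs_of_nonneg (by linarith : 0 ≤ 1 - z)]
    nlinarith

lemma hasDerivAt_mul_abs (r : ℝ) : HasDerivAt (fun y : ℝ => y * |y|) (2 * |r|) r := by
  rcases lt_trichotomy r 0 with h | h | h
  · have h1 : HasDerivAt (fun y : ℝ => y * (-y)) (1 * (-r) + r * (-1)) r :=
      (hasDerivAt_id r).mul (hasDerivAt_id r).neg
    rw [abs_of_neg h]
    refine (h1.congr_of_eventuallyEq ?_).congr_deriv ?_
    · filter_upwards [Iio_mem_nhds h] with y hy
      rw [abs_of_neg hy]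
    · ring
  · subst h
    rw [hasDerivAt_iff_tendsto_slope]
    have : Tendsto (fun y : ℝ => |y|) (nhdsWithin 0 {0}ᶜ) (nhds (2 * |(0:ℝ)|)) := by
      have h := (continuous_abs (G := ℝ)).tendsto 0
      simp only [abs_zero, mul_zero] at h ⊢
      exact h.mono_left nhdsWithin_le_nhds
    refine this.congr' ?_
    filter_upwards [self_mem_nhdsWithin] with y hy
    have : y ≠ 0 := hy
    simp [slope_def_field]
    field_simp
  · have h1 : HasDerivAt (fun y : ℝ => y * y) (1 * r + r * 1) r :=
      (hasDerivAt_id r).mul (hasDerivAt_id r)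
    rw [abs_of_pos h]
    refine (h1.congr_of_eventuallyEq ?_).congr_deriv ?_
    · filter_upwards [Ioi_mem_nhds h] with y hy
      rw [abs_of_pos hy]
    · ring

lemma hasDerivAt_zero_flux (k r : ℝ) :
    HasDerivAt (fun r : ℝ => r * k * |r * k|) (2 * |r| * k * |k|) r := by
  have h1 : HasDerivAt (fun r : ℝ => r * k) k r := by
    simpa using (hasDerivAt_id r).mul_const k
  have := (hasDerivAt_mul_abs (r * k)).comp r h1
  refine this.congr_deriv ?_
  rw [abs_mul]; ring

lemma hasDerivAt_DD (k r : ℝ) (h : r * k ≠ 1) : HasDerivAt (DD k) (Dp k r) r := by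
  have h1 : HasDerivAt (fun r : ℝ => r * k) k r := by
    simpa using (hasDerivAt_id r).mul_const k
  have hc : Continuous (fun r : ℝ => r * k) := by fun_prop
  have h2 : HasDerivAt (fun r : ℝ => |1 - r * k| * (1 + r * k))
      (sgn (1 - r * k) * (-2 * r * k ^ 2)) r := by
    have h3 : HasDerivAt (fun r : ℝ => (1 - r * k) * (1 + r * k))
       ((-k) * (1 + r * k) + (1 - r * k) * k) r :=
       HasDerivAt.mul (h1.const_sub 1) (h1.const_add 1)
    rcases lt_or_gt_of_ne h with h' | h'
    · have hs : sgn (1 - r * k) = 1 := by unfold sgn; rw [if_pos (by linarith)]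
      rw [hs]
      refine (h3.congr_of_eventuallyEq ?_).congr_deriv ?_
      · filter_upwards [hc.continuousAt.eventually_lt continuousAt_const h'] with y hy
        rw [abs_of_pos (by linarith)]
      · ring
    · have hs : sgn (1 - r * k) = -1 := by unfold sgn; rw [if_neg (by linarith)]
      rw [hs]
      refine (h3.neg.congr_of_eventuallyEq ?_).congr_deriv ?_
      · filter_upwards [continuousAt_const.eventually_lt hc.continuousAt h'] with y hy
        rw [abs_of_neg (by linarith)]
        simp only [Pi.neg_apply]
        ring
      · ring
  exact h2.sub (hasDerivAt_zero_flux k r)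

lemma exc_countable (k : ℝ) : {r : ℝ | r * k = 1}.Countable := by
  apply Set.Subsingleton.countable
  intro a ha b hb
  simp only [mem_ofPred_eq] at ha hb
  have hk : k ≠ 0 := by rintro rfl; simp at ha
  exact mul_right_cancel₀ hk (ha.trans hb.symm)

lemma sgn_meas : Measurable sgn := by
  unfold sgn
  exact Measurable.ite measurableSet_Ici measurable_const measurable_const

lemma sgn_bdd (s : ℝ) : ‖sgn s‖ ≤ 1 := by unfold sgn; split_ifs <;> simp

lemma int1 {f : ℝ → ℝ} (hf : Continuous f) {R : ℝ} (h : ∀ r, R ≤ |r| → f r = 0) :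
    Integrable f := by
  refine hf.integrable_of_hasCompactSupport (HasCompactSupport.intro (K := Icc (-R) R) isCompact_Icc ?_)
  intro x hx
  apply h
  by_contra hc
  push Not at hc
  exact hx (abs_le.1 hc.le)

lemma int2 {f : ℝ × ℝ → ℝ} (hf : Continuous f) {R : ℝ}
    (h : ∀ p : ℝ × ℝ, (R ≤ |p.1| ∨ R ≤ |p.2|) → f p = 0) :
    Integrable f ((volume : Measure ℝ).prod volume) := by
  rw [← Measure.volume_eq_prod]
  refine hf.integrable_of_hasCompactSupport
    (HasCompactSupport.intro (K := Icc (-R) R ×ˢ Icc (-R) R) (isCompact_Icc.prod isCompact_Icc) ?_)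
  intro x hx
  apply h
  by_contra hc
  push Not at hc
  exact hx ⟨abs_le.1 hc.1.le, abs_le.1 hc.2.le⟩

lemma int_restr {f : ℝ × ℝ → ℝ} (h : Integrable f ((volume : Measure ℝ).prod volume)) :
    Integrable f ((volume.restrict (Ioi (0:ℝ))).prod volume) :=
  h.mono_measure (Measure.prod_mono Measure.restrict_le_self le_rfl)

/-- fundamental theorem on a half line, off a countable set -/
lemma ftc_Iio {f f' : ℝ → ℝ} {s : Set ℝ} (hs : s.Countable) (hf : Continuous f)
    (hd : ∀ x ∉ s, HasDerivAt f (f' x) x) (hi : Integrable f') {R : ℝ}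
    (h0 : ∀ r, R ≤ |r| → f r = 0) (h1 : ∀ r, R ≤ |r| → f' r = 0) (ρ : ℝ) :
    ∫ r in Iio ρ, f' r = f ρ := by
  set a := min (-|R|) ρ with ha
  have haR : ∀ x ≤ a, R ≤ |x| := by
    intro x hx
    have : x ≤ -|R| := hx.trans (min_le_left _ _)
    have h3 := neg_abs_le x
    have h4 := le_abs_self R
    linarith
  have hle : a ≤ ρ := min_le_right _ _
  rw [← integral_Iic_eq_integral_Iio, ← Iic_union_Ioc_eq_Iic hle,
    setIntegral_union (by rw [Set.disjoint_left]; intro x hx hx'; exact absurd hx'.1 (not_lt.2 hx))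
     measurableSet_Ioc hi.integrableOn hi.integrableOn,
    setIntegral_eq_zero_of_forall_eq_zero (t := Iic a) (fun x hx => h1 x (haR x hx)), zero_add,
    ← intervalIntegral.integral_of_le hle,
    integral_eq_of_hasDerivAt_off_countable f f' hs hf.continuousOn (fun x hx => hd x hx.2)
      hi.intervalIntegrable, h0 a (haR a le_rfl), sub_zero]

lemma ftc_Ioo {f f' : ℝ → ℝ} {s : Set ℝ} (hs : s.Countable) (hf : Continuous f)
    (hd : ∀ x ∉ s, HasDerivAt f (f' x) x) (hi : Integrable f') {a b : ℝ} (hle : a ≤ b) :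
    ∫ r in Ioo a b, f' r = f b - f a := by
  rw [← integral_Ioc_eq_integral_Ioo, ← intervalIntegral.integral_of_le hle,
    integral_eq_of_hasDerivAt_off_countable f f' hs hf.continuousOn (fun x hx => hd x hx.2)
      hi.intervalIntegrable]

lemma ftc_Ioi {f f' : ℝ → ℝ} (hd : ∀ x, HasDerivAt f (f' x) x) (hi : Integrable f') {R : ℝ}
    (h0 : ∀ r, R ≤ |r| → f r = 0) (a : ℝ) : ∫ r in Ioi a, f' r = - f a := by
  rw [integral_Ioi_of_hasDerivAt_of_tendsto' (fun x _ => hd x) hi.integrableOn (m := 0), zero_sub]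
  refine tendsto_const_nhds.congr' ?_
  filter_upwards [eventually_ge_atTop R] with x hx
  exact (h0 x (hx.trans (le_abs_self x))).symm

lemma cov_lin (F : ℝ → ℝ) (c : ℝ) : ∫ r, 2 * F r = ∫ t, F ((t - c) / 2) := by
  have h1 : ∫ t, F ((t - c) / 2) = ∫ t, F (t / 2) :=
    integral_sub_right_eq_self (fun t => F (t / 2)) c
  rw [h1, integral_const_mul, Measure.integral_comp_div]
  simp

lemma cov_sq (F : ℝ → ℝ) : ∫ x, F x = ∫ r : ℝ, 2 * |r| * F (r * |r|) := by
  have hmono : StrictMono (fun y : ℝ => y * |y|) := by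
    intro a b hab
    simp only
    rcases le_total 0 a with ha | ha <;> rcases le_total 0 b with hb | hb
    · rw [abs_of_nonneg ha, abs_of_nonneg hb]; nlinarith
    · linarith
    · rw [abs_of_nonpos ha, abs_of_nonneg hb]
      rcases eq_or_lt_of_le hb with h | h
      · subst h; nlinarith
      · nlinarith
    · rw [abs_of_nonpos ha, abs_of_nonpos hb]; nlinarith
  have hsurj : Function.Surjective (fun y : ℝ => y * |y|) := by
    intro x
    rcases le_total 0 x with h | h
    · exact ⟨√x, by simp [abs_of_nonneg (Real.sqrt_nonneg x), Real.mul_self_sqrt h]⟩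
    · refine ⟨-√(-x), ?_⟩
      simp only [abs_neg, abs_of_nonneg (Real.sqrt_nonneg (-x))]
      have := Real.mul_self_sqrt (neg_nonneg.2 h)
      linarith
  have := integral_image_eq_integral_abs_deriv_smul (s := univ) (f := fun y : ℝ => y * |y|)
    (f' := fun r => 2 * |r|) MeasurableSet.univ (fun x _ => (hasDerivAt_mul_abs x).hasDerivWithinAt)
    hmono.injective.injOn F
  rw [image_univ, hsurj.range_eq, setIntegral_univ, setIntegral_univ] at this
  rw [this]
  congr 1; ext r
  rw [abs_of_nonneg (by positivity), smul_eq_mul]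

lemma int_ite {α : Type*} [MeasurableSpace α] {μ : Measure α} {f : α → ℝ} {P : α → Prop}
    [DecidablePred P] (hP : MeasurableSet {p | P p}) (h : Integrable f μ) :
    Integrable (fun p => if P p then f p else 0) μ := by
  refine (h.indicator hP).congr (ae_of_all _ fun p => ?_)
  by_cases hp : P p <;> simp [hp, indicator]

lemma integral_ite_set {α : Type*} [MeasurableSpace α] {μ : Measure α} {f : α → ℝ} {P : α → Prop}
    [DecidablePred P] (hP : MeasurableSet {p | P p}) :
    ∫ p, (if P p then f p else 0) ∂μ = ∫ p in {p | P p}, f p ∂μ := by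
  rw [← integral_indicator hP]
  congr 1; ext p
  by_cases hp : P p <;> simp [hp, indicator]

/-- the time part of the transformed integrand -/
noncomputable def Tpart (lam k : ℝ) (ψt : ℝ × ℝ → ℝ) (t r : ℝ) : ℝ :=
  2 * |r * k| * ψt (r, t)
    + (if r < 0 ∧ 2 + 2 * r < t then 2 * mm k r * ψt (r, t) else 0)
    + (if 0 < r ∧ 2 + lam + 2 * r < t then 2 * mm k r * ψt (r, t) else 0)

/-- the space part of the transformed integrand -/
noncomputable def Xpart (lam k : ℝ) (ψ ψr : ℝ × ℝ → ℝ) (t r : ℝ) : ℝ :=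
  (r * k * |r * k| * ψr (r, t) + 2 * |r| * k * |k| * ψ (r, t))
    + (if r < 0 ∧ 2 + 2 * r < t then DD k r * ψr (r, t) + Dp k r * ψ (r, t) else 0)
    + (if 0 < r ∧ 2 + lam + 2 * r < t then DD k r * ψr (r, t) + Dp k r * ψ (r, t) else 0)

lemma meas_S1 : MeasurableSet {p : ℝ × ℝ | p.2 < 0 ∧ 2 + 2 * p.2 < p.1} := by
  have h1 : MeasurableSet {p : ℝ × ℝ | p.2 < 0} := measurableSet_lt (by fun_prop) (by fun_prop)
  have h2 : MeasurableSet {p : ℝ × ℝ | 2 + 2 * p.2 < p.1} := measurableSet_lt (by fun_prop) (by fun_prop)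
  exact h1.inter h2

lemma meas_S2 (lam : ℝ) : MeasurableSet {p : ℝ × ℝ | 0 < p.2 ∧ 2 + lam + 2 * p.2 < p.1} := by
  have h1 : MeasurableSet {p : ℝ × ℝ | 0 < p.2} := measurableSet_lt (by fun_prop) (by fun_prop)
  have h2 : MeasurableSet {p : ℝ × ℝ | 2 + lam + 2 * p.2 < p.1} := measurableSet_lt (by fun_prop) (by fun_prop)
  exact h1.inter h2

lemma T_int (lam k R : ℝ) (ψt : ℝ × ℝ → ℝ) (hc : Continuous ψt)
    (hs : ∀ r t, (R ≤ |r| ∨ R ≤ |t|) → ψt (r, t) = 0) :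
    Integrable (Function.uncurry (Tpart lam k ψt)) ((volume : Measure ℝ).prod volume) := by
  have hm := mm_cont k
  have h0 : Integrable (fun p : ℝ × ℝ => 2 * |p.2 * k| * ψt (p.2, p.1))
      ((volume : Measure ℝ).prod volume) :=
    int2 (by fun_prop) (R := R) (fun p hp => by rw [hs _ _ hp.symm, mul_zero])
  have h1 : Integrable (fun p : ℝ × ℝ => 2 * mm k p.2 * ψt (p.2, p.1))
      ((volume : Measure ℝ).prod volume) :=
    int2 (by fun_prop) (R := R) (fun p hp => by rw [hs _ _ hp.symm, mul_zero])
  exact (h0.add (int_ite meas_S1 h1)).add (int_ite (meas_S2 lam) h1)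

lemma Dp_int {α : Type*} [MeasurableSpace α] {μ : Measure α} (k : ℝ) {g ψ : α → ℝ}
    (hg : Measurable g) (h1 : Integrable (fun p => -2 * g p * k ^ 2 * ψ p) μ)
    (h2 : Integrable (fun p => 2 * |g p| * k * |k| * ψ p) μ) :
    Integrable (fun p => Dp k (g p) * ψ p) μ := by
  have h3 : Integrable (fun p => sgn (1 - g p * k) * (-2 * g p * k ^ 2 * ψ p)) μ :=
    h1.bdd_mul (c := 1) (sgn_meas.comp (by fun_prop)).aestronglyMeasurable
      (ae_of_all _ fun p => sgn_bdd _)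
  refine (h3.sub h2).congr (ae_of_all _ fun p => ?_)
  simp only [Dp, Pi.sub_apply]
  ring

lemma X_int (lam k R : ℝ) (ψ ψr : ℝ × ℝ → ℝ) (hc : Continuous ψ) (hcr : Continuous ψr)
    (hs : ∀ r t, (R ≤ |r| ∨ R ≤ |t|) → ψ (r, t) = 0)
    (hsr : ∀ r t, (R ≤ |r| ∨ R ≤ |t|) → ψr (r, t) = 0) :
    Integrable (Function.uncurry (Xpart lam k ψ ψr)) ((volume : Measure ℝ).prod volume) := by
  have hm := DD_cont k
  have h0 : Integrable (fun p : ℝ × ℝ => p.2 * k * |p.2 * k| * ψr (p.2, p.1)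
      + 2 * |p.2| * k * |k| * ψ (p.2, p.1))
      ((volume : Measure ℝ).prod volume) :=
    int2 (by fun_prop) (R := R)
      (fun p hp => by rw [hs _ _ hp.symm, hsr _ _ hp.symm, mul_zero, mul_zero, add_zero])
  have h1 : Integrable (fun p : ℝ × ℝ => DD k p.2 * ψr (p.2, p.1))
      ((volume : Measure ℝ).prod volume) :=
    int2 (by fun_prop) (R := R) (fun p hp => by rw [hsr _ _ hp.symm, mul_zero])
  have h2 : Integrable (fun p : ℝ × ℝ => Dp k p.2 * ψ (p.2, p.1))
      ((volume : Measure ℝ).prod volume) := by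
    refine Dp_int k measurable_snd ?_ ?_
    · exact int2 (by fun_prop) (R := R) (fun p hp => by rw [hs _ _ hp.symm, mul_zero])
    · exact int2 (by fun_prop) (R := R) (fun p hp => by rw [hs _ _ hp.symm, mul_zero])
  exact (h0.add (int_ite meas_S1 (h1.add h2))).add (int_ite (meas_S2 lam) (h1.add h2))

lemma T_inner (lam k R : ℝ) (hl : 0 ≤ lam) (ψ ψt : ℝ × ℝ → ℝ) (hc : Continuous ψt)
    (hd : ∀ r t, HasDerivAt (fun t => ψ (r, t)) (ψt (r, t)) t)
    (hs : ∀ r t, (R ≤ |r| ∨ R ≤ |t|) → ψ (r, t) = 0)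
    (hst : ∀ r t, (R ≤ |r| ∨ R ≤ |t|) → ψt (r, t) = 0) (r : ℝ) :
    ∫ t in Ioi (0:ℝ), Tpart lam k ψt t r =
      - (2 * |r * k| * ψ (r, 0))
      - (if r < 0 then 2 * mm k r * ψ (r, max 0 (2 + 2 * r)) else 0)
      - (if 0 < r then 2 * mm k r * ψ (r, 2 + lam + 2 * r) else 0) := by
  have hi : Integrable (fun t => ψt (r, t)) :=
    int1 (by fun_prop) (R := R) (fun t ht => hst r t (Or.inr ht))
  have hF : ∀ a, ∫ t in Ioi a, ψt (r, t) = - ψ (r, a) := fun a =>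
    ftc_Ioi (f := fun t => ψ (r, t)) (hd r) hi (R := R) (fun t ht => hs r t (Or.inr ht)) a
  have hA : ∀ c : ℝ, ∫ t in Ioi (0:ℝ), (if c < t then 2 * mm k r * ψt (r, t) else 0)
      = - (2 * mm k r * ψ (r, max 0 c)) := by
    intro c
    rw [integral_ite_set (P := fun t => c < t) measurableSet_Ioi]
    have : {t : ℝ | c < t} = Ioi c := rfl
    rw [this, Measure.restrict_restrict measurableSet_Ioi, Ioi_inter_Ioi, integral_const_mul, hF,
      sup_comm]
    ring
  have hB : ∀ c : ℝ, Integrable (fun t => if c < t then 2 * mm k r * ψt (r, t) else 0)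
      (volume.restrict (Ioi (0:ℝ))) := fun c =>
    (int_ite (P := fun t => c < t) measurableSet_Ioi (hi.const_mul _)).restrict
  have h0 : ∫ t in Ioi (0:ℝ), 2 * |r * k| * ψt (r, t) = - (2 * |r * k| * ψ (r, 0)) := by
    rw [integral_const_mul, hF]; ring
  have hi0 : Integrable (fun t => 2 * |r * k| * ψt (r, t)) (volume.restrict (Ioi (0:ℝ))) :=
    (hi.const_mul _).restrict
  unfold Tpart
  rcases lt_trichotomy r 0 with h | h | h
  · simp only [h, true_and, not_lt.2 h.le, false_and, if_false, if_true, add_zero, sub_zero]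
    rw [integral_add hi0 (hB _), h0, hA]; ring
  · simp only [h, lt_irrefl, false_and, if_false, add_zero, sub_zero]
    rw [h] at h0
    exact h0
  · simp only [h, true_and, not_lt.2 h.le, false_and, if_false, if_true, add_zero, sub_zero]
    rw [integral_add hi0 (hB _), h0, hA, max_eq_right (by linarith)]; ring

lemma X_inner (lam k R : ℝ) (ψ ψr : ℝ × ℝ → ℝ) (hc : Continuous ψ) (hcr : Continuous ψr)
    (hd : ∀ r t, HasDerivAt (fun r => ψ (r, t)) (ψr (r, t)) r)
    (hs : ∀ r t, (R ≤ |r| ∨ R ≤ |t|) → ψ (r, t) = 0)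
    (hsr : ∀ r t, (R ≤ |r| ∨ R ≤ |t|) → ψr (r, t) = 0) (t : ℝ) :
    ∫ r, Xpart lam k ψ ψr t r =
      DD k (min ((t - 2) / 2) 0) * ψ (min ((t - 2) / 2) 0, t)
      + (DD k (max ((t - 2 - lam) / 2) 0) * ψ (max ((t - 2 - lam) / 2) 0, t) - ψ (0, t)) := by
  have hm := DD_cont k
  have h0 : ∫ r, (r * k * |r * k| * ψr (r, t) + 2 * |r| * k * |k| * ψ (r, t)) = 0 := by
    refine integral_eq_zero_of_hasDerivAt_of_integrable (f := fun r => r * k * |r * k| * ψ (r, t))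
      (fun r => ((hasDerivAt_zero_flux k r).mul (hd r t)).congr_deriv (by ring)) ?_ ?_
    · exact int1 (by fun_prop) (R := R)
        (fun r hr => by rw [hs _ _ (Or.inl hr), hsr _ _ (Or.inl hr)]; ring)
    · exact int1 (by fun_prop) (R := R) (fun r hr => by rw [hs _ _ (Or.inl hr)]; ring)
  have hi0 : Integrable (fun r => r * k * |r * k| * ψr (r, t) + 2 * |r| * k * |k| * ψ (r, t)) :=
    int1 (by fun_prop) (R := R)
        (fun r hr => by rw [hs _ _ (Or.inl hr), hsr _ _ (Or.inl hr)]; ring)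
  have h1 : Integrable (fun r => DD k r * ψr (r, t)) :=
    int1 (by fun_prop) (R := R) (fun p hp => by rw [hsr _ _ (Or.inl hp), mul_zero])
  have h2 : Integrable (fun r => Dp k r * ψ (r, t)) := by
    refine Dp_int k measurable_id ?_ ?_
    · exact int1 (by fun_prop) (R := R)
        (fun p hp => by rw [hs _ _ (Or.inl hp), mul_zero])
    · exact int1 (by fun_prop) (R := R)
        (fun p hp => by rw [hs _ _ (Or.inl hp), mul_zero])
  have hi : Integrable (fun r => DD k r * ψr (r, t) + Dp k r * ψ (r, t)) := h1.add h2
  have hder : ∀ r ∉ {r : ℝ | r * k = 1}, HasDerivAt (fun r => DD k r * ψ (r, t))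
      (DD k r * ψr (r, t) + Dp k r * ψ (r, t)) r := fun r hr =>
    ((hasDerivAt_DD k r hr).mul (hd r t)).congr_deriv (by ring)
  have hm1 : MeasurableSet {r : ℝ | r < 0 ∧ 2 + 2 * r < t} := by
    have h1 : MeasurableSet {p : ℝ | p < 0} := measurableSet_lt (by fun_prop) (by fun_prop)
    have h2 : MeasurableSet {p : ℝ | 2 + 2 * p < t} := measurableSet_lt (by fun_prop) (by fun_prop)
    exact h1.inter h2
  have hm2 : MeasurableSet {r : ℝ | 0 < r ∧ 2 + lam + 2 * r < t} := by
    have h1 : MeasurableSet {p : ℝ | 0 < p} := measurableSet_lt (by fun_prop) (by fun_prop)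
    have h2 : MeasurableSet {p : ℝ | 2 + lam + 2 * p < t} := measurableSet_lt (by fun_prop) (by fun_prop)
    exact h1.inter h2
  have hS1 : {r : ℝ | r < 0 ∧ 2 + 2 * r < t} = Iio (min ((t - 2) / 2) 0) := by
    ext r
    simp only [mem_ofPred_eq, mem_Iio, lt_min_iff]
    constructor
    · rintro ⟨h, h'⟩; exact ⟨by linarith, h⟩
    · rintro ⟨h, h'⟩; exact ⟨h', by linarith⟩
  have hS2 : {r : ℝ | 0 < r ∧ 2 + lam + 2 * r < t} = Ioo 0 (max ((t - 2 - lam) / 2) 0) := by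
    ext r
    simp only [mem_ofPred_eq, mem_Ioo, lt_max_iff]
    constructor
    · rintro ⟨h, h'⟩; exact ⟨h, Or.inl (by linarith)⟩
    · rintro ⟨h, h' | h'⟩
      · exact ⟨h, by linarith⟩
      · linarith
  have hx1 : ∫ r, (if r < 0 ∧ 2 + 2 * r < t then DD k r * ψr (r, t) + Dp k r * ψ (r, t) else 0)
      = DD k (min ((t - 2) / 2) 0) * ψ (min ((t - 2) / 2) 0, t) := by
    rw [integral_ite_set hm1, hS1]
    exact ftc_Iio (f := fun r => DD k r * ψ (r, t)) (exc_countable k) (by fun_prop) hder hi (R := R)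
      (fun r hr => by rw [hs _ _ (Or.inl hr), mul_zero])
      (fun r hr => by rw [hs _ _ (Or.inl hr), hsr _ _ (Or.inl hr)]; ring) _
  have hx2 : ∫ r, (if 0 < r ∧ 2 + lam + 2 * r < t then
        DD k r * ψr (r, t) + Dp k r * ψ (r, t) else 0)
      = DD k (max ((t - 2 - lam) / 2) 0) * ψ (max ((t - 2 - lam) / 2) 0, t) - ψ (0, t) := by
    rw [integral_ite_set hm2, hS2]
    have := ftc_Ioo (f := fun r => DD k r * ψ (r, t)) (exc_countable k) (by fun_prop) hder hi
      (le_max_right ((t - 2 - lam) / 2) 0)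
    simp only [DD_zero, one_mul] at this
    exact this
  have h01 : Integrable (fun r => (r * k * |r * k| * ψr (r, t) + 2 * |r| * k * |k| * ψ (r, t))
    + (if r < 0 ∧ 2 + 2 * r < t then DD k r * ψr (r, t) + Dp k r * ψ (r, t) else 0)) :=
    hi0.add (int_ite hm1 hi)
  unfold Xpart
  rw [integral_add h01 (int_ite hm2 hi), integral_add hi0 (int_ite hm1 hi),
    h0, hx1, hx2, zero_add]

lemma core (lam k R : ℝ) (hl : 0 ≤ lam) (ψ ψr ψt : ℝ × ℝ → ℝ) (hc : Continuous ψ)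
    (hcr : Continuous ψr) (hct : Continuous ψt)
    (hdr : ∀ r t, HasDerivAt (fun r => ψ (r, t)) (ψr (r, t)) r)
    (hdt : ∀ r t, HasDerivAt (fun t => ψ (r, t)) (ψt (r, t)) t)
    (hs : ∀ r t, (R ≤ |r| ∨ R ≤ |t|) → ψ (r, t) = 0)
    (hsr : ∀ r t, (R ≤ |r| ∨ R ≤ |t|) → ψr (r, t) = 0)
    (hst : ∀ r t, (R ≤ |r| ∨ R ≤ |t|) → ψt (r, t) = 0)
    (hn : ∀ p, 0 ≤ ψ p) :
    0 ≤ (∫ t in Ioi (0:ℝ), ∫ r, (Tpart lam k ψt t r + Xpart lam k ψ ψr t r))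
      + ∫ r, (2 * |r * k| * ψ (r, 0) + (if r < -1 then 2 * mm k r * ψ (r, 0) else 0)) := by
  have hm := mm_cont k
  have hDc := DD_cont k
  have hT := int_restr (T_int lam k R ψt hct hst)
  have hX := int_restr (X_int lam k R ψ ψr hc hcr hs hsr)
  have e1 : (∫ t in Ioi (0:ℝ), ∫ r, (Tpart lam k ψt t r + Xpart lam k ψ ψr t r))
      = (∫ t in Ioi (0:ℝ), ∫ r, Tpart lam k ψt t r) + ∫ t in Ioi (0:ℝ), ∫ r, Xpart lam k ψ ψr t r :=
    integral_integral_add hT hX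
  have hXi : IntegrableOn (fun t => ∫ r, Xpart lam k ψ ψr t r) (Ioi (0:ℝ)) := hX.integral_prod_left
  have hTi : Integrable (fun r => ∫ t in Ioi (0:ℝ), Tpart lam k ψt t r) := hT.integral_prod_right
  rw [e1, integral_integral_swap hT]
  have hstart : Integrable (fun r => 2 * |r * k| * ψ (r, 0)
      + (if r < -1 then 2 * mm k r * ψ (r, 0) else 0)) := by
    refine Integrable.add ?_ (int_ite measurableSet_Iio ?_)
    · exact int1 (by fun_prop) (R := R) (fun r hr => by rw [hs _ _ (Or.inl hr)]; ring)
    · exact int1 (by fun_prop) (R := R) (fun r hr => by rw [hs _ _ (Or.inl hr)]; ring)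
  -- functions on the two fronts
  let F1 : ℝ → ℝ := fun r => if -1 ≤ r ∧ r < 0 then mm k r * ψ (r, 2 + 2 * r) else 0
  let F2 : ℝ → ℝ := fun r => if 0 < r then mm k r * ψ (r, 2 + lam + 2 * r) else 0
  have hF1 : Integrable F1 := by
    refine int_ite (measurableSet_Ico (a := (-1:ℝ)) (b := 0)) ?_
    exact int1 (by fun_prop) (R := R) (fun r hr => by rw [hs _ _ (Or.inl hr)]; ring)
  have hF2 : Integrable F2 := by
    refine int_ite (measurableSet_Ioi (a := (0:ℝ))) ?_
    exact int1 (by fun_prop) (R := R) (fun r hr => by rw [hs _ _ (Or.inl hr)]; ring)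
  have e2 : (∫ r, ∫ t in Ioi (0:ℝ), Tpart lam k ψt t r)
      + ∫ r, (2 * |r * k| * ψ (r, 0) + (if r < -1 then 2 * mm k r * ψ (r, 0) else 0))
      = - (∫ r, 2 * F1 r) - ∫ r, 2 * F2 r := by
    have hF1n : Integrable (fun r => -(2 * F1 r)) := (hF1.const_mul 2).neg
    rw [← integral_add hTi hstart, ← integral_neg, ← integral_sub hF1n (hF2.const_mul 2)]
    congr 1; ext r
    rw [T_inner lam k R hl ψ ψt hct hdt hs hst]
    simp only [F1, F2]
    rcases lt_or_ge r (-1) with h | h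
    · rw [if_pos (by linarith), if_neg (by linarith), if_pos h, if_neg (by intro h'; linarith [h'.1]),
        if_neg (by linarith), max_eq_left (by linarith)]
      ring
    · rcases lt_or_ge r 0 with h0 | h0
      · rw [if_pos h0, if_neg (by linarith), if_neg (by linarith), if_pos ⟨h, h0⟩,
          if_neg (by linarith), max_eq_right (by linarith)]
        ring
      · rw [if_neg (not_lt.2 h0 : ¬ r < 0), if_neg (not_lt.2 h : ¬ r < -1),
          if_neg (by intro h'; linarith [h'.2] : ¬ (-1 ≤ r ∧ r < 0))]
        split_ifs <;> ring
  have e3 : ∀ F : ℝ → ℝ, ∀ c, Integrable F → Integrable (fun t => F ((t - c) / 2)) := by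
    intro F c hF
    exact (hF.comp_div (by norm_num : (2:ℝ) ≠ 0)).comp_sub_right c
  have hset : ∀ F : ℝ → ℝ, (∀ t ≤ 0, F t = 0) → ∫ t, F t = ∫ t in Ioi (0:ℝ), F t := by
    intro F hF
    refine (setIntegral_eq_integral_of_forall_compl_eq_zero ?_).symm
    intro t ht
    exact hF t (not_lt.1 ht)
  have hae : ∫ r, F1 ((r - 2) / 2) = ∫ t in Ioi (0:ℝ), F1 ((t - 2) / 2) := by
    rw [← integral_Ici_eq_integral_Ioi]
    refine (setIntegral_eq_integral_of_forall_compl_eq_zero ?_).symm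
    intro t ht
    have : t < 0 := not_le.1 ht
    simp only [F1]
    rw [if_neg (by intro h; linarith [h.1])]
  have hF2s : ∫ r, F2 ((r - (2 + lam)) / 2) = ∫ t in Ioi (0:ℝ), F2 ((t - (2 + lam)) / 2) := by
    refine hset _ ?_
    intro t ht
    simp only [F2]
    rw [if_neg (by linarith)]
  have hfin : 0 ≤ ∫ t in Ioi (0:ℝ), ((∫ r, Xpart lam k ψ ψr t r) - F1 ((t - 2) / 2)
      - F2 ((t - (2 + lam)) / 2)) := by
    refine setIntegral_nonneg measurableSet_Ioi ?_
    intro t ht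
    have ht : 0 < t := ht
    rw [X_inner lam k R ψ ψr hc hcr hdr hs hsr]
    simp only [F1, F2]
    have hx : ∀ r s, 0 ≤ (DD k r - mm k r) * ψ (r, s) := fun r s =>
      mul_nonneg (sub_nonneg.2 (mm_le_DD k r)) (hn _)
    rcases lt_or_ge t 2 with h | h
    · rw [if_pos ⟨by linarith, by linarith⟩, if_neg (by linarith), min_eq_left (by linarith),
        max_eq_right (by linarith), DD_zero]
      have e : 2 + 2 * ((t - 2) / 2) = t := by ring
      rw [e]
      have := hx ((t - 2) / 2) t
      linarith
    · rw [if_neg (by intro h'; linarith [h'.2]), min_eq_right (by linarith), DD_zero]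
      rcases le_or_gt t (2 + lam) with h' | h'
      · rw [if_neg (by linarith), max_eq_right (by linarith), DD_zero]
        have := hn (0, t)
        linarith
      · rw [if_pos (by linarith), max_eq_left (by linarith)]
        have e : 2 + lam + 2 * ((t - (2 + lam)) / 2) = t := by ring
        have e' : t - 2 - lam = t - (2 + lam) := by ring
        rw [e, e']
        have := hx ((t - (2 + lam)) / 2) t
        linarith
  have hX1 : IntegrableOn (fun t => (∫ r, Xpart lam k ψ ψr t r) - F1 ((t - 2) / 2)) (Ioi (0:ℝ)) :=
    hXi.sub (e3 F1 2 hF1).integrableOn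
  rw [integral_sub hX1 (e3 F2 _ hF2).integrableOn,
    integral_sub hXi (e3 F1 2 hF1).integrableOn, ← hae, ← hF2s, ← cov_lin, ← cov_lin] at hfin
  linarith

lemma sgn_neg_mul (k : ℝ) : sgn (-k) * k ^ 2 = - (k * |k|) := by
  unfold sgn
  split_ifs with h
  · rw [abs_of_nonpos (by linarith)]; ring
  · rw [abs_of_pos (by linarith)]; ring

lemma sgn_mul_self (s : ℝ) : sgn s * s = |s| := by
  unfold sgn
  split_ifs with h
  · rw [abs_of_nonneg h]; ring
  · rw [abs_of_neg (by linarith)]; ring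

lemma sgn_inv (k r : ℝ) (h0 : r ≠ 0) (h1 : r * k ≠ 1) :
    sgn (1 / r - k) * |r| = r * sgn (1 - r * k) := by
  have e : 1 / r - k = (1 - r * k) / r := by field_simp
  rw [e]
  unfold sgn
  rcases lt_or_gt_of_ne h0 with h | h
  · rw [abs_of_neg h]
    rcases lt_or_gt_of_ne h1 with h' | h'
    · rw [if_neg (not_le.2 (div_neg_of_pos_of_neg (by linarith) h)), if_pos (by linarith)]; ring
    · rw [if_pos (div_nonneg_of_nonpos (by linarith) h.le), if_neg (by linarith)]; ring
  · rw [abs_of_pos h]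
    rcases lt_or_gt_of_ne h1 with h' | h'
    · rw [if_pos (div_nonneg (by linarith) h.le), if_pos (by linarith)]; ring
    · rw [if_neg (not_le.2 (div_neg_of_neg_of_pos (by linarith) h)), if_neg (by linarith)]; ring

lemma abs_inv_sub (k r : ℝ) (h0 : r ≠ 0) : |r| * |1 / r - k| = |1 - r * k| := by
  rw [← abs_mul]
  congr 1
  field_simp

lemma sqrt_sq_neg (r : ℝ) (h : r < 0) : √(-(r * |r|)) = -r := by
  rw [abs_of_neg h, show -(r * -r) = (-r) ^ 2 by ring, Real.sqrt_sq (by linarith)]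

lemma sqrt_sq_pos (r : ℝ) (h : 0 < r) : √(r * |r|) = r := by
  rw [abs_of_pos h, show r * r = r ^ 2 by ring, Real.sqrt_sq h.le]

lemma wFam_sq (lam t r : ℝ) (hl : 0 ≤ lam) : wFam lam (r * |r|, t) =
    if (r < 0 ∧ 2 + 2 * r < t) ∨ (0 < r ∧ 2 + lam + 2 * r < t) then 1 / r else 0 := by
  unfold wFam
  simp only
  have hA := le_max_right (2 - t) 0
  have hA' := le_max_left (2 - t) 0
  have hB := le_max_right (t - 2 - lam) 0
  have hB' := le_max_left (t - 2 - lam) 0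
  rcases lt_trichotomy r 0 with h | h | h
  · have c1 : (r * |r| < -((max (2 - t) 0) ^ 2 / 4)) ↔ 2 + 2 * r < t := by
      rw [abs_of_neg h]
      constructor
      · intro h1
        by_contra hc
        push Not at hc
        nlinarith
      · intro h1
        have : max (2 - t) 0 < -2 * r := max_lt (by linarith) (by linarith)
        nlinarith
    have c2 : ¬ (0 < r * |r|) := by rw [abs_of_neg h]; nlinarith
    simp only [c1, c2, h, not_lt.2 h.le, false_and, true_and, or_false, if_false]
    rw [sqrt_sq_neg r h, neg_div_neg_eq]
  · subst h
    have : ¬ ((0:ℝ) < -((max (2 - t) 0) ^ 2 / 4)) := by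
      have := sq_nonneg (max (2 - t) 0); linarith
    simp [this]
  · have c1 : ¬ (r * |r| < -((max (2 - t) 0) ^ 2 / 4)) := by
      rw [abs_of_pos h]
      nlinarith [sq_nonneg (max (2 - t) 0)]
    have c2 : (0 < r * |r|) := by rw [abs_of_pos h]; nlinarith
    have c3 : (r * |r| < (max (t - 2 - lam) 0) ^ 2 / 4) ↔ 2 + lam + 2 * r < t := by
      rw [abs_of_pos h]
      constructor
      · intro h1
        by_contra hc
        push Not at hc
        have : max (t - 2 - lam) 0 ≤ 2 * r := max_le (by linarith) (by linarith)
        nlinarith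
      · intro h1
        nlinarith
    simp only [c1, c2, c3, h, not_lt.2 h.le, false_and, true_and, false_or, if_false]
    rw [sqrt_sq_pos r h]

lemma uInit_sq (r : ℝ) : uInit (r * |r|) = if r < -1 then 1 / r else 0 := by
  unfold uInit
  have c : r * |r| < -1 ↔ r < -1 := by
    rcases lt_or_ge r 0 with h | h
    · rw [abs_of_neg h]
      constructor <;> intro h' <;> nlinarith
    · rw [abs_of_nonneg h]
      constructor <;> intro h' <;> nlinarith
  simp only [c]
  split_ifs with h
  · rw [sqrt_sq_neg r (by linarith), neg_div_neg_eq]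
  · rfl

lemma integrand_eq (lam k t r a b c : ℝ) (hl : 0 ≤ lam) (h0 : r ≠ 0) (h1 : r * k ≠ 1)
    (φ ψr ψt : ℝ × ℝ → ℝ) (hφ : φ (r, t) = a) (hr : ψr (r, t) = 2 * |r| * b) (ht : ψt (r, t) = c) :
    2 * |r| * (|wFam lam (r * |r|, t) - k| * c
      + sgn (wFam lam (r * |r|, t) - k)
          * (r * |r| * (wFam lam (r * |r|, t)) ^ 2 - r * |r| * k ^ 2) * b
      - sgn (wFam lam (r * |r|, t) - k) * k ^ 2 * a)
    = Tpart lam k ψt t r + Xpart lam k φ ψr t r := by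
  unfold Tpart Xpart
  rw [hφ, hr, ht, wFam_sq lam t r hl]
  have z1 := sgn_neg_mul k
  have z2 : |r * k| = |r| * |k| := abs_mul r k
  have zero_case : 2 * |r| * (|0 - k| * c
      + sgn (0 - k) * (r * |r| * (0:ℝ) ^ 2 - r * |r| * k ^ 2) * b - sgn (0 - k) * k ^ 2 * a)
      = 2 * |r * k| * c + (r * k * |r * k| * (2 * |r| * b) + 2 * |r| * k * |k| * a) := by
    rw [zero_sub, abs_neg, z2]
    linear_combination (-2 * |r| * (r * |r| * b) - 2 * |r| * a) * z1
  have one_case : 2 * |r| * (|1 / r - k| * c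
      + sgn (1 / r - k) * (r * |r| * (1 / r) ^ 2 - r * |r| * k ^ 2) * b
      - sgn (1 / r - k) * k ^ 2 * a)
      = 2 * |r * k| * c + (r * k * |r * k| * (2 * |r| * b) + 2 * |r| * k * |k| * a)
       + 2 * mm k r * c + (DD k r * (2 * |r| * b) + Dp k r * a) := by
    have y1 := abs_inv_sub k r h0
    have y2 := sgn_inv k r h0 h1
    have y3 := sgn_mul_self (1 - r * k)
    have y4 : r * |r| * (1 / r) ^ 2 - r * |r| * k ^ 2 = |r| * (1 / r - r * k ^ 2) := by
      field_simp
    have y5 : r * (1 / r - r * k ^ 2) = (1 - r * k) * (1 + r * k) := by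
      field_simp; ring
    rw [y4]
    unfold mm DD Dp
    have y6 : sgn (1 / r - k) * (|r| * (1 / r - r * k ^ 2)) = |1 - r * k| * (1 + r * k) := by
      linear_combination (1 / r - r * k ^ 2) * y2 + sgn (1 - r * k) * y5 + (1 + r * k) * y3
    linear_combination 2 * c * y1 + 2 * |r| * b * y6 - 2 * k ^ 2 * a * y2
  by_cases hS1 : r < 0 ∧ 2 + 2 * r < t
  · have hS2 : ¬ (0 < r ∧ 2 + lam + 2 * r < t) := fun h => absurd h.1 (not_lt.2 hS1.1.le)
    rw [if_pos (Or.inl hS1), if_pos hS1, if_neg hS2, if_pos hS1, if_neg hS2, one_case]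
    ring
  · by_cases hS2 : 0 < r ∧ 2 + lam + 2 * r < t
    · rw [if_pos (Or.inr hS2), if_neg hS1, if_pos hS2, if_neg hS1, if_pos hS2, one_case]
      ring
    · rw [if_neg (by tauto), if_neg hS1, if_neg hS2, if_neg hS1, if_neg hS2, zero_case]
      ring

lemma start_eq (k r a : ℝ) : 2 * |r| * (|uInit (r * |r|) - k| * a)
    = 2 * |r * k| * a + (if r < -1 then 2 * mm k r * a else 0) := by
  rw [uInit_sq]
  split_ifs with h
  · have y1 := abs_inv_sub k r (by linarith)
    unfold mm
    linear_combination 2 * a * y1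
  · rw [zero_sub, abs_neg, abs_mul]; ring

lemma entropy (lam : ℝ) (hl : 0 ≤ lam) : EntropySol (wFam lam) uInit := by
  intro k φ hφ hsupp hn
  have hφd : Differentiable ℝ φ := hφ.differentiable (by simp)
  have hfc : Continuous (fderiv ℝ φ) := hφ.continuous_fderiv (by simp)
  have hcφ : Continuous φ := hφ.continuous
  have hφx : Continuous (fun p : ℝ × ℝ => fderiv ℝ φ p (1, 0)) := hfc.clm_apply continuous_const
  have hφt : Continuous (fun p : ℝ × ℝ => fderiv ℝ φ p (0, 1)) := hfc.clm_apply continuous_const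
  obtain ⟨M, hM⟩ := hsupp.isCompact.isBounded.subset_closedBall (0 : ℝ × ℝ)
  have hzero : ∀ p : ℝ × ℝ, M < |p.1| ∨ M < |p.2| → φ p = 0 ∧ fderiv ℝ φ p = 0 := by
    intro p hp
    have hnot : p ∉ tsupport φ := by
      intro h
      have := hM h
      rw [mem_closedBall_zero_iff, Prod.norm_def, sup_le_iff] at this
      rcases hp with hp | hp
      · exact absurd this.1 (not_le.2 hp)
      · exact absurd this.2 (not_le.2 hp)
    refine ⟨image_eq_zero_of_notMem_tsupport hnot, ?_⟩
    by_contra hc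
    exact hnot (support_fderiv_subset ℝ hc)
  set R := |M| + 2 with hR
  have hz : ∀ r t : ℝ, (R ≤ |r| ∨ R ≤ |t|) → M < abs (r * |r|) ∨ M < |t| := by
    intro r t h
    have := le_abs_self M
    have := abs_nonneg M
    rcases h with h | h
    · left
      rw [abs_mul, abs_abs]
      nlinarith
    · right; linarith
  have hcore := core lam k R hl (fun p => φ (p.1 * |p.1|, p.2))
    (fun p => 2 * |p.1| * fderiv ℝ φ (p.1 * |p.1|, p.2) (1, 0))
    (fun p => fderiv ℝ φ (p.1 * |p.1|, p.2) (0, 1))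
    (by fun_prop)
    ((by fun_prop : Continuous fun p : ℝ × ℝ => 2 * |p.1|).mul
      (hφx.comp (by fun_prop : Continuous fun p : ℝ × ℝ => (p.1 * |p.1|, p.2))))
    (hφt.comp (by fun_prop : Continuous fun p : ℝ × ℝ => (p.1 * |p.1|, p.2)))
    (by
      intro r t
      have h1 : HasDerivAt (fun r : ℝ => (r * |r|, t)) (2 * |r|, (0:ℝ)) r :=
        (hasDerivAt_mul_abs r).prodMk (hasDerivAt_const r t)
      have h2 := (hφd (r * |r|, t)).hasFDerivAt.comp_hasDerivAt r h1
      refine h2.congr_deriv ?_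
      have : ((2 * |r|, (0:ℝ)) : ℝ × ℝ) = (2 * |r|) • ((1:ℝ), (0:ℝ)) := by simp
      rw [this, map_smul, smul_eq_mul])
    (by
      intro r t
      have h1 : HasDerivAt (fun t : ℝ => (r * |r|, t)) ((0:ℝ), (1:ℝ)) t :=
        (hasDerivAt_const t (r * |r|)).prodMk (hasDerivAt_id t)
      exact (hφd (r * |r|, t)).hasFDerivAt.comp_hasDerivAt t h1)
    (fun r t h => (hzero _ (hz r t h)).1)
    (fun r t h => by simp [(hzero (r * |r|, t) (hz r t h)).2])
    (fun r t h => by simp [(hzero (r * |r|, t) (hz r t h)).2])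
    (fun p => hn _)
  convert hcore using 2
  · congr 1
    ext t
    rw [cov_sq]
    refine integral_congr_ae ?_
    filter_upwards [(exc_countable k).ae_notMem volume,
      (Set.countable_singleton (0:ℝ)).ae_notMem volume] with r h1 h0
    exact integrand_eq lam k t r _ _ _ hl h0 h1 _ _ _ rfl rfl rfl
  · rw [cov_sq]
    congr 1
    ext r
    exact start_eq k r _

lemma uInit_bdd (x : ℝ) : |uInit x| ≤ 1 := by
  unfold uInit
  split_ifs with h
  · rw [abs_div, abs_neg, abs_one, abs_of_nonneg (Real.sqrt_nonneg _)]
    have : 1 ≤ √(-x) := Real.one_le_sqrt.2 (by linarith)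
    rw [div_le_one (by linarith)]
    exact this
  · simp

lemma uInit_sup : (⨆ x : ℝ, |uInit x|) = 1 := by
  apply le_antisymm (ciSup_le uInit_bdd)
  apply le_of_forall_lt_imp_le_of_dense
  intro c hc
  have hbdd : BddAbove (range fun x => |uInit x|) := ⟨1, by rintro _ ⟨x, rfl⟩; exact uInit_bdd x⟩
  set s := max c (1 / 2) with hs
  have h1 : s < 1 := max_lt hc (by norm_num)
  have h2 : 0 < s := lt_of_lt_of_le (by norm_num) (le_max_right _ _)
  have hr : -1 / s < -1 := by
    rw [div_lt_iff₀ h2]; linarith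
  refine le_trans ?_ (le_ciSup hbdd ((-1 / s) * |(-1 / s)|))
  rw [uInit_sq, if_pos hr]
  have : (1:ℝ) / (-1 / s) = -s := by field_simp
  rw [this, abs_neg, abs_of_pos h2]
  exact le_max_left _ _

lemma l1_cont (lam : ℝ) (hl : 0 ≤ lam) (K : Set ℝ) :
    Tendsto (fun t => ∫ x in K, |wFam lam (x, t) - uInit x|)
        (nhdsWithin 0 (Ioi 0)) (nhds 0) := by
  have hlim : Tendsto (fun t : ℝ => 2 * t) (nhdsWithin 0 (Ioi 0)) (nhds 0) := by
    have : Tendsto (fun t : ℝ => 2 * t) (nhds 0) (nhds (2 * 0)) :=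
      (by fun_prop : Continuous fun t : ℝ => 2 * t).tendsto 0
    rw [mul_zero] at this
    exact this.mono_left nhdsWithin_le_nhds
  refine squeeze_zero' (Eventually.of_forall fun t => integral_nonneg fun x => abs_nonneg _) ?_ hlim
  filter_upwards [Ioo_mem_nhdsGT (zero_lt_one' ℝ)] with t ht
  have hg : Integrable (indicator (Ico (-1:ℝ) (-1 + t)) fun _ => (2:ℝ)) :=
    (integrable_indicator_iff measurableSet_Ico).2 (integrableOn_const (by simp))
  have hle : ∀ x, |wFam lam (x, t) - uInit x| ≤ indicator (Ico (-1:ℝ) (-1 + t)) (fun _ => (2:ℝ)) x := by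
    intro x
    have hpos : 0 ≤ indicator (Ico (-1:ℝ) (-1 + t)) (fun _ => (2:ℝ)) x :=
      indicator_nonneg (fun _ _ => by norm_num) x
    unfold wFam uInit
    simp only
    rw [max_eq_left (by linarith [ht.2]), max_eq_right (by linarith [ht.2] : t - 2 - lam ≤ 0)]
    have hno : ¬ (0 < x ∧ x < (0:ℝ) ^ 2 / 4) := by
      rintro ⟨h, h'⟩; norm_num at h'; linarith
    rw [if_neg hno]
    by_cases h1 : x < -1
    · rw [if_pos h1, if_pos (by nlinarith [ht.1, ht.2]), sub_self, abs_zero]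
      exact hpos
    · rw [if_neg h1, sub_zero]
      split_ifs with h2
      · rw [indicator_of_mem (show x ∈ Ico (-1:ℝ) (-1 + t) from ⟨not_lt.1 h1, by nlinarith [ht.1, ht.2]⟩), abs_div, abs_neg, abs_one,
          abs_of_nonneg (Real.sqrt_nonneg _)]
        have : 1 / 2 ≤ √(-x) := Real.le_sqrt_of_sq_le (by nlinarith [ht.1, ht.2])
        rw [div_le_iff₀ (by linarith)]
        linarith
      · rw [abs_zero]; exact hpos
  calc ∫ x in K, |wFam lam (x, t) - uInit x|
      ≤ ∫ x in K, indicator (Ico (-1:ℝ) (-1 + t)) (fun _ => (2:ℝ)) x :=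
        integral_mono_of_nonneg (ae_of_all _ fun x => abs_nonneg _) hg.restrict (ae_of_all _ hle)
    _ ≤ ∫ x, indicator (Ico (-1:ℝ) (-1 + t)) (fun _ => (2:ℝ)) x :=
        setIntegral_le_integral hg (ae_of_all _ fun x => indicator_nonneg (fun _ _ => by norm_num) x)
    _ = 2 * t := by
        rw [integral_indicator measurableSet_Ico, setIntegral_const]
        simp [Measure.real, ht.1.le, mul_comm]

lemma differ_aux (lam mu : ℝ) (hl : 0 ≤ lam) (h : lam < mu) :
    0 < volume {p : ℝ × ℝ | 0 < p.2 ∧ wFam lam p ≠ wFam mu p} := by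
  have ho : IsOpen (((fun p : ℝ × ℝ => p.2) ⁻¹' Ioo (2 + lam) (2 + mu)) ∩
      ((fun p : ℝ × ℝ => p.1) ⁻¹' Ioi 0 ∩
       (fun p : ℝ × ℝ => (p.2 - 2 - lam) ^ 2 / 4 - p.1) ⁻¹' Ioi 0)) :=
    (isOpen_Ioo.preimage (by fun_prop)).inter
      ((isOpen_Ioi.preimage (by fun_prop)).inter (isOpen_Ioi.preimage (by fun_prop)))
  refine lt_of_lt_of_le (ho.measure_pos volume ⟨(((mu - lam) / 2) ^ 2 / 8, 2 + (lam + mu) / 2), ?_⟩)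
    (measure_mono ?_)
  · have : 0 < (mu - lam) ^ 2 := by nlinarith
    refine ⟨⟨?_, ?_⟩, ?_, ?_⟩
    · simp only; linarith
    · simp only; linarith
    · simp only [mem_preimage, mem_Ioi]; nlinarith
    · simp only [mem_preimage, mem_Ioi]; nlinarith
  · rintro ⟨x, t⟩ ⟨⟨h1, h2⟩, h3, h4⟩
    simp only [mem_preimage, mem_Ioi] at h1 h2 h3 h4
    refine ⟨by simp only; linarith, ?_⟩
    have hA : ¬ (x < -((max (2 - t) 0) ^ 2 / 4)) := by nlinarith [sq_nonneg (max (2 - t) 0)]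
    unfold wFam
    simp only
    rw [if_neg hA, if_neg hA, max_eq_left (by linarith), max_eq_right (by linarith : t - 2 - mu ≤ 0),
      if_pos ⟨h3, by linarith⟩, if_neg (by rintro ⟨h, h'⟩; norm_num at h'; linarith)]
    have := Real.sqrt_pos.2 h3
    positivity

/-- each `w_λ` (λ ≥ 0) is a Kružkov entropy solution of
`u_t + (x u²)_x = 0` with the bounded initial datum `uInit` (with `‖uInit‖_∞ = 1`),
each is `L¹_loc`-continuous at `t = 0`, and distinct parameters give solutions
differing on a set of positive measure: infinitely many entropy solutions from
bounded initial data. -/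
theorem statement2 :
    (∀ x : ℝ, |uInit x| ≤ 1) ∧ (⨆ x : ℝ, |uInit x|) = 1 ∧
    (∀ lam : ℝ, 0 ≤ lam → EntropySol (wFam lam) uInit) ∧
    (∀ lam : ℝ, 0 ≤ lam → ∀ K : Set ℝ, IsCompact K →
      Tendsto (fun t => ∫ x in K, |wFam lam (x, t) - uInit x|)
        (nhdsWithin 0 (Ioi 0)) (nhds 0)) ∧
    (∀ lam mu : ℝ, 0 ≤ lam → 0 ≤ mu → lam ≠ mu →
      0 < volume {p : ℝ × ℝ | 0 < p.2 ∧ wFam lam p ≠ wFam mu p}) := by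
  refine ⟨uInit_bdd, uInit_sup, entropy, fun lam hl K _ => l1_cont lam hl K, ?_⟩
  intro lam mu hl hm hne
  rcases lt_or_gt_of_ne hne with h | h
  · exact differ_aux lam mu hl h
  · have := differ_aux mu lam hm h
    simpa only [ne_comm] using this
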